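/- Let A be an N×N complex matrix (N ≥ 2) with Aᴴ = A and A·A = A, and let ε₁, ε₂ be the first two standard basis vectors of ℂ^N. Then 2·Re A₁₂ = 1 if and only if A·(ε₁+ε₂) = ε₁+ε₂ and A·(ε₁−ε₂) = 0; and 2·Re A₁₂ = −1 if and only if A·(ε₁−ε₂) = ε₁−ε₂ and A·(ε₁+ε₂) = 0. Thus the extreme level sets g⁻¹(1) and g⁻¹(−1) of g(A) = 2·Re A₁₂ on rank-n Hermitian idempotents consist exactly of the projections onto n-dimensional subspaces containing (ε₁+ε₂)/√2 (respectively (ε₁−ε₂)/√2) whose intersection with the orthogonal complement of that vector lies in span(ε₃,…,ε_N). -/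

import Mathlib

open scoped Matrix

namespace Matrix

variable {n : Type*} [Fintype n] {A : Matrix n n ℂ}

theorem star_mulVec_dotProduct_mulVec_of_idempotent (hherm : Aᴴ = A) (hidem : A * A = A)
    (x : n → ℂ) : star (A *ᵥ x) ⬝ᵥ (A *ᵥ x) = star x ⬝ᵥ (A *ᵥ x) := by
  rw [star_mulVec, hherm, ← dotProduct_mulVec, mulVec_mulVec, hidem]

theorem star_sub_mulVec_dotProduct_of_idempotent (hherm : Aᴴ = A) (hidem : A * A = A)
    (x : n → ℂ) :
    star (x - A *ᵥ x) ⬝ᵥ (x - A *ᵥ x) = star x ⬝ᵥ x - star x ⬝ᵥ (A *ᵥ x) := by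
  have h : star (A *ᵥ x) ⬝ᵥ x = star x ⬝ᵥ (A *ᵥ x) := by
    rw [star_mulVec, hherm, ← dotProduct_mulVec]
  rw [star_sub, sub_dotProduct, dotProduct_sub, dotProduct_sub,
    star_mulVec_dotProduct_mulVec_of_idempotent hherm hidem, h]
  ring

open scoped ComplexOrder in
/-- An orthogonal projection fixes `x` and kills `y` exactly when the difference of its quadratic
form at `x` and `y` attains its upper bound `‖x‖ ^ 2`. -/
theorem mulVec_eq_self_and_mulVec_eq_zero_iff (hherm : Aᴴ = A) (hidem : A * A = A)
    (x y : n → ℂ) :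
    (A *ᵥ x = x ∧ A *ᵥ y = 0) ↔
      star x ⬝ᵥ (A *ᵥ x) - star y ⬝ᵥ (A *ᵥ y) = star x ⬝ᵥ x := by
  constructor
  · rintro ⟨hx, hy⟩
    simp [hx, hy]
  · intro h
    have hsum : star (x - A *ᵥ x) ⬝ᵥ (x - A *ᵥ x) + star (A *ᵥ y) ⬝ᵥ (A *ᵥ y) = 0 := by
      rw [star_sub_mulVec_dotProduct_of_idempotent hherm hidem,
        star_mulVec_dotProduct_mulVec_of_idempotent hherm hidem, ← h]
      ring
    obtain ⟨hx, hy⟩ := (add_eq_zero_iff_of_nonneg (dotProduct_star_self_nonneg _)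
      (dotProduct_star_self_nonneg _)).1 hsum
    exact ⟨(sub_eq_zero.1 (dotProduct_star_self_eq_zero.1 hx)).symm,
      dotProduct_star_self_eq_zero.1 hy⟩

variable [DecidableEq n]

theorem quadratic_form_single_add_sub_quadratic_form_single_sub (hherm : Aᴴ = A) (i j : n) :
    star (Pi.single i 1 + Pi.single j 1 : n → ℂ) ⬝ᵥ (A *ᵥ (Pi.single i 1 + Pi.single j 1)) -
      star (Pi.single i 1 - Pi.single j 1 : n → ℂ) ⬝ᵥ (A *ᵥ (Pi.single i 1 - Pi.single j 1)) =
        ((4 * (A i j).re : ℝ) : ℂ) := by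
  have hji : A j i = star (A i j) := by rw [← conjTranspose_apply, hherm]
  have hre : A i j + star (A i j) = ((2 * (A i j).re : ℝ) : ℂ) := Complex.add_conj _
  push_cast at hre ⊢
  simp only [star_add, star_sub, Pi.star_single, star_one, mulVec_add, mulVec_sub,
    add_dotProduct, sub_dotProduct, dotProduct_add, dotProduct_sub, single_one_dotProduct,
    mulVec_single_one, col_apply, hji]
  linear_combination 2 * hre

theorem star_single_add_dotProduct_self {i j : n} (hij : i ≠ j) :
    star (Pi.single i 1 + Pi.single j 1 : n → ℂ) ⬝ᵥ (Pi.single i 1 + Pi.single j 1) = 2 := by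
  simp [Pi.star_single, hij, hij.symm, one_add_one_eq_two]

theorem star_single_sub_dotProduct_self {i j : n} (hij : i ≠ j) :
    star (Pi.single i 1 - Pi.single j 1 : n → ℂ) ⬝ᵥ (Pi.single i 1 - Pi.single j 1) = 2 := by
  simp [Pi.star_single, hij, hij.symm, one_add_one_eq_two]

end Matrix

/-- For an `N×N` complex matrix `A` (`N ≥ 2`) with `Aᴴ = A` and `A·A = A`, and `ε₁, ε₂`
the first two standard basis vectors: `2·Re A₁₂ = 1` iff `A·(ε₁+ε₂) = ε₁+ε₂` and
`A·(ε₁−ε₂) = 0`; and `2·Re A₁₂ = −1` iff `A·(ε₁−ε₂) = ε₁−ε₂` and `A·(ε₁+ε₂) = 0`.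
Thus the extreme level sets `g⁻¹(1)` and `g⁻¹(−1)` of `g(A) = 2·Re A₁₂` consist of the
projections onto subspaces containing `(ε₁+ε₂)/√2` (resp. `(ε₁−ε₂)/√2`) and orthogonal
to `(ε₁−ε₂)/√2` (resp. `(ε₁+ε₂)/√2`). -/
theorem extreme_level_sets_of_entry_one_two (N : ℕ) (hN : 2 ≤ N)
    (A : Matrix (Fin N) (Fin N) ℂ) (hherm : Aᴴ = A) (hidem : A * A = A) :
    (2 * (A ⟨0, by omega⟩ ⟨1, by omega⟩).re = 1 ↔
      (A.mulVec (Pi.single ⟨0, by omega⟩ 1 + Pi.single ⟨1, by omega⟩ 1) =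
          Pi.single ⟨0, by omega⟩ 1 + Pi.single ⟨1, by omega⟩ 1 ∧
        A.mulVec (Pi.single ⟨0, by omega⟩ 1 - Pi.single ⟨1, by omega⟩ 1) = 0)) ∧
    (2 * (A ⟨0, by omega⟩ ⟨1, by omega⟩).re = -1 ↔
      (A.mulVec (Pi.single ⟨0, by omega⟩ 1 - Pi.single ⟨1, by omega⟩ 1) =
          Pi.single ⟨0, by omega⟩ 1 - Pi.single ⟨1, by omega⟩ 1 ∧
        A.mulVec (Pi.single ⟨0, by omega⟩ 1 + Pi.single ⟨1, by omega⟩ 1) = 0)) := by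
  have hij : (⟨0, by omega⟩ : Fin N) ≠ ⟨1, by omega⟩ := by simp
  have hq := Matrix.quadratic_form_single_add_sub_quadratic_form_single_sub hherm
    ⟨0, by omega⟩ ⟨1, by omega⟩
  constructor
  · rw [Matrix.mulVec_eq_self_and_mulVec_eq_zero_iff hherm hidem, hq,
      Matrix.star_single_add_dotProduct_self hij]
    norm_cast
    constructor <;> intro h <;> linarith
  · rw [Matrix.mulVec_eq_self_and_mulVec_eq_zero_iff hherm hidem, ← neg_sub, hq,
      Matrix.star_single_sub_dotProduct_self hij]
    rw [← Complex.ofReal_neg, ← Complex.ofReal_ofNat, Complex.ofReal_inj]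
    constructor <;> intro h <;> linarith
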